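/- arXiv:0911.3682 — 4 statements merged into one kernel-verified Lean document; each statement's English description precedes it below -/
import Mathlib

section
/- The automorphism group of SL(2,3) × C₂ × C₂ (a group of order 96, where SL(2,3) is the special linear group of 2×2 matrices of determinant 1 over the field with 3 elements) is isomorphic to S₄ × S₄. -/
namespace SL23ProdKlein

open Matrix

/-- The special linear group of degree two over the field with three elements. -/
abbrev SL23 := SpecialLinearGroup (Fin 2) (ZMod 3)

/-- The Klein four-group. -/
abbrev Klein := Multiplicative (ZMod 2) × Multiplicative (ZMod 2)

/-! ### Elements of order three -/

/-- The line fixed by an element of order three of `SL(2,3)`, as a point of the projective line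
over `ZMod 3`, with `none` as the point at infinity. -/
def line (g : SL23) : Option (ZMod 3) :=
  if g.1 1 0 = 0 then none else some ((g.1 0 0 - 1) * g.1 1 0)

/-- A transvection fixing a given point of the projective line. -/
def transvection : Option (ZMod 3) → SL23
  | none => ⟨!![1, 1; 0, 1], by decide⟩
  | some t => ⟨!![1 + t, -t ^ 2; 1, 1 - t], by rw [det_fin_two_of]; ring⟩

theorem line_transvection : ∀ x, line (transvection x) = x := by decide +kernel

theorem transvection_pow_three : ∀ x, transvection x ^ 3 = 1 := by decide +kernel

theorem transvection_ne_one : ∀ x, transvection x ≠ 1 := by decide +kernel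

theorem eq_transvection_or_inv : ∀ g : SL23, g ^ 3 = 1 → g ≠ 1 →
    g = transvection (line g) ∨ g = (transvection (line g))⁻¹ := by decide +kernel

theorem line_inv : ∀ g : SL23, g ^ 3 = 1 → line g⁻¹ = line g := by decide +kernel

theorem exists_transvection_word : ∀ g : SL23, ∃ i j k l : Fin 3,
    g = transvection none ^ i.1 * transvection (some 0) ^ j.1 *
      transvection none ^ k.1 * transvection (some 0) ^ l.1 := by decide +kernel

theorem klein_eq_one_of_pow_three : ∀ v : Klein, v ^ 3 = 1 → v = 1 := by decide +kernel

theorem map_eq_of_pow_three (φ : MulAut (SL23 × Klein)) {g : SL23} (hg : g ^ 3 = 1) :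
    φ (g, 1) = ((φ (g, 1)).1, 1) := by
  have h : φ (g, 1) ^ 3 = 1 := by
    rw [← map_pow, Prod.pow_mk, hg, one_pow, ← Prod.one_eq_mk, map_one]
  exact Prod.ext rfl (klein_eq_one_of_pow_three _ (congrArg Prod.snd h))

theorem map_fst_pow_three (φ : MulAut (SL23 × Klein)) {g : SL23} (hg : g ^ 3 = 1) :
    (φ (g, 1)).1 ^ 3 = 1 := by
  rw [← Prod.pow_fst, ← map_pow, Prod.pow_mk, hg, one_pow, ← Prod.one_eq_mk, map_one, Prod.fst_one]

theorem map_fst_ne_one (φ : MulAut (SL23 × Klein)) {g : SL23} (hg : g ^ 3 = 1) (hg1 : g ≠ 1) :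
    (φ (g, 1)).1 ≠ 1 := by
  intro h
  have := map_eq_of_pow_three φ hg
  rw [h, ← Prod.one_eq_mk, map_eq_one_iff φ φ.injective] at this
  exact hg1 (congrArg Prod.fst this)

theorem line_map_transvection_line (φ : MulAut (SL23 × Klein)) {g : SL23} (hg : g ^ 3 = 1)
    (hg1 : g ≠ 1) : line (φ (transvection (line g), 1)).1 = line (φ (g, 1)).1 := by
  rcases eq_transvection_or_inv g hg hg1 with h | h
  · rw [← h]
  · have h' : ((g, 1) : SL23 × Klein) = (transvection (line g), 1)⁻¹ := by
      rw [Prod.inv_mk, inv_one, ← h]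
    rw [h', map_inv, Prod.fst_inv, line_inv _ (map_fst_pow_three φ (transvection_pow_three _))]

/-- The action of automorphisms on the four Sylow `3`-subgroups, each labelled by the line it
fixes. -/
def lineAction : MulAut (SL23 × Klein) →* Equiv.Perm (Option (ZMod 3)) :=
  MonoidHom.toHomPerm
    { toFun := fun φ x ↦ line (φ (transvection x, 1)).1
      map_one' := funext line_transvection
      map_mul' := fun φ ψ ↦ funext fun x ↦ by
        have hx := transvection_pow_three x
        change line (φ (ψ (transvection x, 1))).1 =
          line (φ (transvection (line (ψ (transvection x, 1)).1), 1)).1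
        rw [line_map_transvection_line φ (map_fst_pow_three ψ hx)
          (map_fst_ne_one ψ hx (transvection_ne_one x)), ← map_eq_of_pow_three ψ hx] }

theorem lineAction_apply (φ : MulAut (SL23 × Klein)) (x : Option (ZMod 3)) :
    lineAction φ x = line (φ (transvection x, 1)).1 := rfl

theorem line_map_eq_of_lineAction_eq_one {φ : MulAut (SL23 × Klein)} (h : lineAction φ = 1)
    {g : SL23} (hg : g ^ 3 = 1) (hg1 : g ≠ 1) : line (φ (g, 1)).1 = line g := by
  rw [← line_map_transvection_line φ hg hg1, ← lineAction_apply, h, Equiv.Perm.one_apply]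

theorem map_transvections_of_lineAction_eq_one {φ : MulAut (SL23 × Klein)}
    (h : lineAction φ = 1) :
    φ (transvection none, 1) = (transvection none, 1) ∧
      φ (transvection (some 0), 1) = (transvection (some 0), 1) := by
  have key (x) : φ (transvection x, 1) = (transvection x, 1) ∨
      φ (transvection x, 1) = (transvection x, 1)⁻¹ := by
    have hx := transvection_pow_three x
    have hl := line_map_eq_of_lineAction_eq_one h hx (transvection_ne_one x)
    rw [line_transvection] at hl
    have := eq_transvection_or_inv _ (map_fst_pow_three φ hx)
      (map_fst_ne_one φ hx (transvection_ne_one x))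
    rw [hl] at this
    rw [map_eq_of_pow_three φ hx]
    exact this.imp (fun h ↦ by rw [h]) (fun h ↦ by rw [h, Prod.inv_mk, inv_one])
  have conj (x y) : line (φ (transvection x, 1) * φ (transvection y, 1) *
      (φ (transvection x, 1))⁻¹).1 = line (transvection x * transvection y *
        (transvection x)⁻¹) := by
    rw [← map_inv, ← map_mul, ← map_mul, ← line_map_eq_of_lineAction_eq_one h
      (g := transvection x * transvection y * (transvection x)⁻¹)]
    · rw [Prod.inv_mk, Prod.mk_mul_mk, Prod.mk_mul_mk, inv_one, mul_one, mul_one]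
    · rw [conj_pow, transvection_pow_three, mul_one, mul_inv_cancel]
    · rw [ne_eq, conj_eq_one_iff]
      exact transvection_ne_one y
  have h₁ := conj none (some 0)
  have h₂ := conj (some 0) none
  rcases key none with ha | ha <;> rcases key (some 0) with hb | hb <;>
    rw [ha, hb] at h₁ h₂
  · exact ⟨ha, hb⟩
  · exact absurd h₂ (by decide +kernel)
  · exact absurd h₁ (by decide +kernel)
  · exact absurd h₁ (by decide +kernel)

theorem map_inl_of_lineAction_eq_one {φ : MulAut (SL23 × Klein)} (h : lineAction φ = 1)
    (g : SL23) : φ (g, 1) = (g, 1) := by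
  obtain ⟨ha, hb⟩ := map_transvections_of_lineAction_eq_one h
  obtain ⟨i, j, k, l, rfl⟩ := exists_transvection_word g
  have hw : ((transvection none ^ i.1 * transvection (some 0) ^ j.1 *
      transvection none ^ k.1 * transvection (some 0) ^ l.1, 1) : SL23 × Klein) =
      (transvection none, 1) ^ i.1 * (transvection (some 0), 1) ^ j.1 *
      (transvection none, 1) ^ k.1 * (transvection (some 0), 1) ^ l.1 := by
    simp only [Prod.pow_mk, Prod.mk_mul_mk, one_pow, mul_one]
  simp only [hw, map_mul, map_pow, ha, hb]

/-! ### Elements of order two -/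

theorem eq_one_or_neg_one_of_sq : ∀ g : SL23, g ^ 2 = 1 → g = 1 ∨ g = -1 := by decide +kernel

theorem sq_eq_neg_one : ∀ g : SL23, g ^ 4 = 1 → g ^ 2 ≠ 1 → g ^ 2 = -1 := by decide +kernel

theorem exists_sq_eq_neg_one : ∃ g : SL23, g ^ 2 = -1 := by decide +kernel

theorem klein_sq : ∀ v : Klein, v ^ 2 = 1 := by decide +kernel

theorem map_neg_one (φ : MulAut (SL23 × Klein)) : φ (-1, 1) = (-1, 1) := by
  obtain ⟨w, hw⟩ := exists_sq_eq_neg_one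
  have hz : ((-1, 1) : SL23 × Klein) = (w, 1) ^ 2 := by rw [Prod.pow_mk, hw, one_pow]
  have hsq : φ (-1, 1) = ((φ (w, 1)).1 ^ 2, 1) := by
    rw [hz, map_pow]
    exact Prod.ext rfl (klein_sq _)
  have h4 : (φ (w, 1)).1 ^ 4 = 1 := by
    have : ((w, 1) : SL23 × Klein) ^ 4 = 1 := by
      rw [show 4 = 2 * 2 from rfl, pow_mul, ← hz]
      decide +kernel
    rw [← Prod.pow_fst, ← map_pow, this, map_one, Prod.fst_one]
  rw [hsq, sq_eq_neg_one _ h4]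
  intro h
  rw [h, ← Prod.one_eq_mk, map_eq_one_iff φ φ.injective] at hsq
  exact absurd hsq (by decide +kernel)

/-- The function which, on the elementary abelian group of elements of order at most two, is
the linear functional taking the value `1` at `(-1, 1)` and with coordinates `y` on `Klein`. -/
def functional (y : ZMod 2 × ZMod 2) (t : SL23 × Klein) : ZMod 2 :=
  (if t.1 = 1 then 0 else 1) + (y.1 * t.2.1.toAdd + y.2 * t.2.2.toAdd)

theorem functional_one (y : ZMod 2 × ZMod 2) : functional y 1 = 0 := by
  simp [functional]

theorem functional_mul (y : ZMod 2 × ZMod 2) {t u : SL23 × Klein} (ht : t ^ 2 = 1)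
    (hu : u ^ 2 = 1) : functional y (t * u) = functional y t + functional y u := by
  obtain ⟨g, v⟩ := t
  obtain ⟨h, w⟩ := u
  have hne : (-1 : SL23) ≠ 1 := by decide +kernel
  have h2 : (1 : ZMod 2) + 1 = 0 := by decide
  rcases eq_one_or_neg_one_of_sq g (congrArg Prod.fst ht) with rfl | rfl <;>
    rcases eq_one_or_neg_one_of_sq h (congrArg Prod.fst hu) with rfl | rfl <;>
    simp only [functional, Prod.mk_mul_mk, Prod.fst_mul, Prod.snd_mul, toAdd_mul, one_mul, mul_one,
      neg_mul_neg, hne, if_true, if_false]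
  · ring
  · ring
  · ring
  · linear_combination -h2

theorem eq_of_functional_eq {t u : SL23 × Klein} (ht : t ^ 2 = 1) (hu : u ^ 2 = 1)
    (h : ∀ y, functional y t = functional y u) : t = u := by
  obtain ⟨g, v⟩ := t
  obtain ⟨k, w⟩ := u
  rcases eq_one_or_neg_one_of_sq g (congrArg Prod.fst ht) with rfl | rfl <;>
    rcases eq_one_or_neg_one_of_sq k (congrArg Prod.fst hu) with rfl | rfl <;>
    clear ht hu <;> revert v w <;> decide +kernel

/-- The first basis vector of the Klein four-group. -/
def e₁ : Klein := (.ofAdd 1, 1)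

/-- The second basis vector of the Klein four-group. -/
def e₂ : Klein := (1, .ofAdd 1)

theorem klein_cases : ∀ v : Klein, v = 1 ∨ v = e₁ ∨ v = e₂ ∨ v = e₁ * e₂ := by decide +kernel

theorem inr_sq (v : Klein) : ((1, v) : SL23 × Klein) ^ 2 = 1 := by
  rw [Prod.pow_mk, one_pow, klein_sq]
  rfl

theorem involution_induction {p : SL23 × Klein → Prop}
    (one : p 1) (neg : p (-1, 1)) (left : p (1, e₁)) (right : p (1, e₂))
    (mul : ∀ t u, t ^ 2 = 1 → u ^ 2 = 1 → p t → p u → p (t * u))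
    {t : SL23 × Klein} (ht : t ^ 2 = 1) : p t := by
  obtain ⟨g, v⟩ := t
  have hv : p (1, v) := by
    rcases klein_cases v with rfl | rfl | rfl | rfl
    · exact one
    · exact left
    · exact right
    · simpa using mul _ _ (inr_sq e₁) (inr_sq e₂) left right
  rcases eq_one_or_neg_one_of_sq g (congrArg Prod.fst ht) with rfl | rfl
  · exact hv
  · simpa using mul (-1, 1) (1, v) (by decide +kernel) (inr_sq v) neg hv

/-- The coordinates on `Klein` of a functional precomposed with the automorphism `ψ`. -/
def pullback (ψ : MulAut (SL23 × Klein)) (y : ZMod 2 × ZMod 2) : ZMod 2 × ZMod 2 :=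
  (functional y (ψ (1, e₁)), functional y (ψ (1, e₂)))

theorem functional_pullback (ψ : MulAut (SL23 × Klein)) (y : ZMod 2 × ZMod 2)
    {t : SL23 × Klein} (ht : t ^ 2 = 1) :
    functional (pullback ψ y) t = functional y (ψ t) := by
  have hne : (-1 : SL23) ≠ 1 := by decide +kernel
  refine involution_induction (p := fun t ↦ functional (pullback ψ y) t = functional y (ψ t))
    ?_ ?_ ?_ ?_ (fun t u ht hu h₁ h₂ ↦ ?_) ht
  · rw [map_one, functional_one, functional_one]
  · rw [map_neg_one]
    simp [functional, hne]
  · simp [functional, pullback, e₁]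
  · simp [functional, pullback, e₂]
  · rw [map_mul, functional_mul _ ht hu, functional_mul, h₁, h₂]
    · rw [← map_pow, ht, map_one]
    · rw [← map_pow, hu, map_one]

/-- The action of automorphisms on the four functionals that do not vanish at `(-1, 1)`. -/
def functionalAction : MulAut (SL23 × Klein) →* Equiv.Perm (ZMod 2 × ZMod 2) :=
  MonoidHom.toHomPerm
    { toFun := fun φ ↦ pullback φ⁻¹
      map_one' := funext fun y ↦ by
        simp [pullback, functional, e₁, e₂, Function.End.one_def]
      map_mul' := fun φ ψ ↦ funext fun y ↦ by
        have h (v : Klein) : (φ⁻¹ (1, v)) ^ 2 = 1 := by rw [← map_pow, inr_sq, map_one]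
        change pullback (φ * ψ)⁻¹ y =
          (functional (pullback ψ⁻¹ y) (φ⁻¹ (1, e₁)), functional (pullback ψ⁻¹ y) (φ⁻¹ (1, e₂)))
        rw [functional_pullback _ _ (h _), functional_pullback _ _ (h _), _root_.mul_inv_rev]
        rfl }

theorem functionalAction_apply (φ : MulAut (SL23 × Klein)) (y : ZMod 2 × ZMod 2) :
    functionalAction φ y = pullback φ⁻¹ y := rfl

theorem map_inr_of_functionalAction_eq_one {φ : MulAut (SL23 × Klein)}
    (h : functionalAction φ = 1) (v : Klein) : φ (1, v) = (1, v) := by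
  have hinv : φ⁻¹ (1, v) = (1, v) := by
    refine eq_of_functional_eq (by rw [← map_pow, inr_sq, map_one]) (inr_sq v) fun y ↦ ?_
    rw [← functional_pullback _ _ (inr_sq v), ← functionalAction_apply, h, Equiv.Perm.one_apply]
  conv_lhs => rw [← hinv]
  exact MulAut.apply_inv_self _ φ _

/-! ### Automorphisms with prescribed actions -/

/-- Conjugation by `diag(1, -1)`, as a function. -/
def flipMap (g : SL23) : SL23 :=
  ⟨!![g.1 0 0, -g.1 0 1; -g.1 1 0, g.1 1 1], by
    have h := g.2
    rw [det_fin_two] at h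
    rw [det_fin_two_of]
    linear_combination h⟩

theorem flipMap_flipMap : ∀ g : SL23, flipMap (flipMap g) = g := by decide +kernel

theorem flipMap_mul (g h : SL23) : flipMap (g * h) = flipMap g * flipMap h := by
  have mul_entry (g h : SL23) (i j) : (g * h).1 i j = g.1 i 0 * h.1 0 j + g.1 i 1 * h.1 1 j :=
    (Matrix.mul_apply ..).trans (Fin.sum_univ_two _)
  refine Subtype.ext (Matrix.ext fun i j ↦ ?_)
  rw [mul_entry]
  fin_cases i <;> fin_cases j <;> simp [flipMap, mul_entry] <;> ring

/-- Conjugation by `diag(1, -1)`. -/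
def flip : MulAut SL23 where
  toFun := flipMap
  invFun := flipMap
  left_inv := flipMap_flipMap
  right_inv := flipMap_flipMap
  map_mul' := flipMap_mul

theorem exists_conj_line_eq : ∀ σ : Equiv.Perm (Option (ZMod 3)), ∃ g : SL23,
    (∀ x, line (g * transvection x * g⁻¹) = σ x) ∨
      ∀ x, line (g * flip (transvection x) * g⁻¹) = σ x := by decide +kernel

theorem exists_mulAut_line_eq (σ : Equiv.Perm (Option (ZMod 3))) :
    ∃ α : MulAut SL23, ∀ x, line (α (transvection x)) = σ x := by
  obtain ⟨g, hg | hg⟩ := exists_conj_line_eq σ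
  · exact ⟨MulAut.conj g, hg⟩
  · exact ⟨MulAut.conj g * flip, hg⟩

theorem exists_lineAction_eq (σ : Equiv.Perm (Option (ZMod 3))) :
    ∃ φ : MulAut (SL23 × Klein), lineAction φ = σ ∧ functionalAction φ = 1 := by
  obtain ⟨α, hα⟩ := exists_mulAut_line_eq σ
  refine ⟨MulEquiv.prodCongr α (MulEquiv.refl Klein), Equiv.ext hα, Equiv.ext fun y ↦ ?_⟩
  have h (v : Klein) : (MulEquiv.prodCongr α (MulEquiv.refl Klein) : MulAut (SL23 × Klein))⁻¹
      (1, v) = (1, v) := Prod.ext (map_one α.symm) rfl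
  rw [functionalAction_apply, pullback, h, h]
  simp [functional, e₁, e₂]

/-- The homomorphism from the Klein four-group to `{1, -1}` with coordinates `c`. -/
def sign (c : ZMod 2 × ZMod 2) : Klein →* SL23 where
  toFun v := if c.1 * v.1.toAdd + c.2 * v.2.toAdd = 0 then 1 else -1
  map_one' := by simp
  map_mul' := by revert c; decide +kernel

theorem sign_mul_comm (c : ZMod 2 × ZMod 2) (v : Klein) (g : SL23) :
    sign c v * g = g * sign c v := by
  simp only [sign, MonoidHom.coe_mk, OneHom.coe_mk]
  split_ifs <;> simp

theorem sign_mul_self (c : ZMod 2 × ZMod 2) (v : Klein) : sign c v * sign c v = 1 := by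
  rw [← map_mul, ← sq, klein_sq, map_one]

/-- The central automorphism that multiplies the first component by a sign of the second. -/
def shear (c : ZMod 2 × ZMod 2) : MulAut (SL23 × Klein) where
  toFun t := (t.1 * sign c t.2, t.2)
  invFun t := (t.1 * sign c t.2, t.2)
  left_inv t := by simp only [mul_assoc, sign_mul_self, mul_one]
  right_inv t := by simp only [mul_assoc, sign_mul_self, mul_one]
  map_mul' t u := by
    refine Prod.ext ?_ rfl
    simp only [Prod.fst_mul, Prod.snd_mul, map_mul, mul_assoc]
    rw [← mul_assoc (sign c t.2) u.1, sign_mul_comm c t.2 u.1, mul_assoc]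

/-- The action of a matrix on the Klein four-group. -/
def linearMap (m : SpecialLinearGroup (Fin 2) (ZMod 2)) (v : Klein) : Klein :=
  (.ofAdd (m.1 0 0 * v.1.toAdd + m.1 0 1 * v.2.toAdd),
    .ofAdd (m.1 1 0 * v.1.toAdd + m.1 1 1 * v.2.toAdd))

/-- The automorphism of the Klein four-group given by an invertible matrix. -/
def linearAut (m : SpecialLinearGroup (Fin 2) (ZMod 2)) : MulAut Klein where
  toFun := linearMap m
  invFun := linearMap m⁻¹
  left_inv := by revert m; unfold Function.LeftInverse; decide +kernel
  right_inv := by revert m; unfold Function.RightInverse Function.LeftInverse; decide +kernel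
  map_mul' := by revert m; decide +kernel

theorem exists_affine_eq : ∀ τ : Equiv.Perm (ZMod 2 × ZMod 2), ∃ c : ZMod 2 × ZMod 2,
    ∃ m : SpecialLinearGroup (Fin 2) (ZMod 2), ∀ y,
      (functional y (sign c e₁, linearMap m e₁), functional y (sign c e₂, linearMap m e₂)) =
        τ y := by decide +kernel

theorem exists_functionalAction_eq (τ : Equiv.Perm (ZMod 2 × ZMod 2)) :
    ∃ φ : MulAut (SL23 × Klein), lineAction φ = 1 ∧ functionalAction φ = τ := by
  obtain ⟨c, m, h⟩ := exists_affine_eq τ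
  let ψ : MulAut (SL23 × Klein) := MulEquiv.prodCongr (MulEquiv.refl SL23) (linearAut m) * shear c
  have hψ (g : SL23) (v : Klein) : ψ (g, v) = (g * sign c v, linearMap m v) := rfl
  refine ⟨ψ⁻¹, ?_, Equiv.ext fun y ↦ ?_⟩
  · rw [map_inv, inv_eq_one]
    ext1 x
    rw [lineAction_apply, hψ, map_one, mul_one, line_transvection, Equiv.Perm.one_apply]
  · rw [functionalAction_apply, inv_inv, pullback, hψ, hψ, one_mul, one_mul, h]

theorem bijective_lineAction_prod_functionalAction :
    Function.Bijective (lineAction.prod functionalAction) := by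
  constructor
  · refine (injective_iff_map_eq_one _).2 fun φ h ↦ MulEquiv.ext fun ⟨g, v⟩ ↦ ?_
    have ht : ((g, v) : SL23 × Klein) = (g, 1) * (1, v) := by simp
    rw [MulAut.one_apply, ht, map_mul, map_inl_of_lineAction_eq_one (congrArg Prod.fst h),
      map_inr_of_functionalAction_eq_one (congrArg Prod.snd h)]
  · rintro ⟨σ, τ⟩
    obtain ⟨φ, h₁, h₂⟩ := exists_lineAction_eq σ
    obtain ⟨ψ, h₃, h₄⟩ := exists_functionalAction_eq τ
    exact ⟨φ * ψ, by simp [h₁, h₂, h₃, h₄]⟩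

end SL23ProdKlein

open SL23ProdKlein in
/-- The automorphism group of `SL(2,3) × C₂ × C₂` (a group of order 96) is isomorphic
to `S₄ × S₄`. -/
theorem aut_SL23xC2xC2_iso_S4xS4 :
    Nonempty
      (MulAut (Matrix.SpecialLinearGroup (Fin 2) (ZMod 3) × Multiplicative (ZMod 2) ×
          Multiplicative (ZMod 2)) ≃*
        Equiv.Perm (Fin 4) × Equiv.Perm (Fin 4)) :=
  ⟨(MulEquiv.ofBijective _ bijective_lineAction_prod_functionalAction).trans
    (MulEquiv.prodCongr (Fintype.equivFinOfCardEq rfl).permCongrHom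
      (Fintype.equivFinOfCardEq rfl).permCongrHom)⟩
end

section
/- The automorphism group of SL(2,3) × C₄ (a group of order 96, where SL(2,3) is the special linear group of 2×2 matrices of determinant 1 over the field with 3 elements) is isomorphic to S₄ × C₂ × C₂. -/
open scoped IsMulCommutative

section ProdAut

variable {H K : Type*} [Group H] [CommGroup K]

/-- The automorphism `(h, k) ↦ (α h * β k, δ k)` of `H × K`, for `α ∈ Aut H`, `δ ∈ Aut K` and a
homomorphism `β` from `K` to the centre of `H` that is invariant under `Aut K`. -/
def prodAut (hβ : ∀ (β : K →* Subgroup.center H) (δ : MulAut K) (k : K), β (δ k) = β k)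
    (p : MulAut H × MulAut K × (K →* Subgroup.center H)) : MulAut (H × K) where
  toFun x := (p.1 x.1 * p.2.2 x.2, p.2.1 x.2)
  invFun x := (p.1⁻¹ (x.1 * (p.2.2 x.2 : H)⁻¹), p.2.1⁻¹ x.2)
  left_inv x := by simp [hβ]
  right_inv x := by simp [hβ]
  map_mul' x y := by
    have h : (p.2.2 x.2 : H) * p.1 y.1 = p.1 y.1 * p.2.2 x.2 :=
      (Subgroup.mem_center_iff.1 (p.2.2 x.2).2 _).symm
    ext
    · simp only [Prod.fst_mul, Prod.snd_mul, map_mul, Subgroup.coe_mul, mul_assoc]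
      rw [← mul_assoc (p.2.2 x.2 : H) (p.1 y.1), h, mul_assoc]
    · simp

theorem snd_apply_of_hom_trivial (hHK : ∀ φ : H →* K, φ = 1) (f : MulAut (H × K)) (h : H) :
    (f (h, 1)).2 = 1 :=
  DFunLike.congr_fun (hHK ((MonoidHom.snd H K).comp (f.toMonoidHom.comp (MonoidHom.inl H K)))) h

theorem inv_apply_fst_apply (hHK : ∀ φ : H →* K, φ = 1) (f g : MulAut (H × K)) (hgf : g * f = 1)
    (h : H) : (g ((f (h, 1)).1, 1)).1 = h := by
  have e : ((f (h, 1)).1, (1 : K)) = f (h, 1) :=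
    Prod.ext rfl (snd_apply_of_hom_trivial hHK f h).symm
  rw [e, ← MulAut.mul_apply, hgf, MulAut.one_apply]

theorem snd_apply_eq (hHK : ∀ φ : H →* K, φ = 1) (f : MulAut (H × K)) (x : H × K) :
    (f x).2 = (f (1, x.2)).2 := by
  have e : x = (x.1, 1) * (1, x.2) := by simp
  conv_lhs => rw [e, map_mul]
  rw [Prod.snd_mul, snd_apply_of_hom_trivial hHK, one_mul]

theorem inv_apply_snd_apply (hHK : ∀ φ : H →* K, φ = 1) (f g : MulAut (H × K)) (hgf : g * f = 1)
    (k : K) : (g (1, (f (1, k)).2)).2 = k := by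
  rw [← snd_apply_eq hHK g (f (1, k)), ← MulAut.mul_apply, hgf, MulAut.one_apply]

theorem prodAut_surjective (hHK : ∀ φ : H →* K, φ = 1)
    (hβ : ∀ (β : K →* Subgroup.center H) (δ : MulAut K) (k : K), β (δ k) = β k) :
    Function.Surjective (prodAut hβ) := by
  intro f
  let α : MulAut H :=
    { toFun h := (f (h, 1)).1
      invFun h := (f⁻¹ (h, 1)).1
      left_inv h := inv_apply_fst_apply hHK f f⁻¹ (inv_mul_cancel f) h
      right_inv h := inv_apply_fst_apply hHK f⁻¹ f (mul_inv_cancel f) h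
      map_mul' h h' := by rw [← Prod.fst_mul, ← map_mul]; simp }
  let δ : MulAut K :=
    { toFun k := (f (1, k)).2
      invFun k := (f⁻¹ (1, k)).2
      left_inv k := inv_apply_snd_apply hHK f f⁻¹ (inv_mul_cancel f) k
      right_inv k := inv_apply_snd_apply hHK f⁻¹ f (mul_inv_cancel f) k
      map_mul' k k' := by rw [← Prod.snd_mul, ← map_mul]; simp }
  let β : K →* Subgroup.center H :=
    ((MonoidHom.fst H K).comp (f.toMonoidHom.comp (MonoidHom.inr H K))).codRestrict
      (Subgroup.center H) fun k => by
        refine Subgroup.mem_center_iff.2 fun h => ?_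
        obtain ⟨h, rfl⟩ := α.surjective h
        change (f (h, 1)).1 * (f (1, k)).1 = (f (1, k)).1 * (f (h, 1)).1
        rw [← Prod.fst_mul, ← Prod.fst_mul, ← map_mul, ← map_mul]
        simp
  refine ⟨(α, δ, β), MulEquiv.ext fun x => ?_⟩
  refine Prod.ext ?_ (snd_apply_eq hHK f x).symm
  change (f (x.1, 1)).1 * (f (1, x.2)).1 = _
  rw [← Prod.fst_mul, ← map_mul]
  simp

theorem prodAut_injective
    (hβ : ∀ (β : K →* Subgroup.center H) (δ : MulAut K) (k : K), β (δ k) = β k) :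
    Function.Injective (prodAut hβ) := by
  rintro ⟨α, δ, β⟩ ⟨α', δ', β'⟩ e
  have e' (h : H) (k : K) : (α h * β k, δ k) = (α' h * (β' k : H), δ' k) :=
    DFunLike.congr_fun e (h, k)
  have hα : α = α' := MulEquiv.ext fun h => by simpa using congrArg Prod.fst (e' h 1)
  have hδ : δ = δ' := MulEquiv.ext fun k => congrArg Prod.snd (e' 1 k)
  have hβ' : β = β' := MonoidHom.ext fun k => by simpa using congrArg Prod.fst (e' 1 k)
  rw [hα, hδ, hβ']

/-- If there are no nontrivial homomorphisms `H → K`, the automorphisms of `H` fix its centre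
pointwise, and homomorphisms from `K` to the centre of `H` are invariant under `Aut K`, then
`Aut (H × K) ≃ Aut H × Aut K × Hom (K, Z(H))`. -/
noncomputable def mulAutProdEquiv (hHK : ∀ φ : H →* K, φ = 1)
    (hα : ∀ (α : MulAut H), ∀ z ∈ Subgroup.center H, α z = z)
    (hβ : ∀ (β : K →* Subgroup.center H) (δ : MulAut K) (k : K), β (δ k) = β k) :
    MulAut H × MulAut K × (K →* Subgroup.center H) ≃* MulAut (H × K) where
  __ := Equiv.ofBijective (prodAut hβ) ⟨prodAut_injective hβ, prodAut_surjective hHK hβ⟩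
  map_mul' p q := by
    refine MulEquiv.ext fun x => Prod.ext ?_ rfl
    change p.1 (q.1 x.1) * (p.2.2 x.2 * q.2.2 x.2 : H) =
      p.1 (q.1 x.1 * q.2.2 x.2) * p.2.2 (q.2.1 x.2)
    rw [map_mul, hα p.1 _ (q.2.2 x.2).2, hβ, mul_assoc,
      Subgroup.mem_center_iff.1 (p.2.2 x.2).2 (q.2.2 x.2 : H)]

end ProdAut

section CyclicFour

local notation "C4" => Multiplicative (ZMod 4)

theorem mulAut_C4_apply (δ : MulAut C4) (k : C4) : δ k = k ∨ δ k = k⁻¹ := by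
  have h4 : ∀ x y : C4, (x * x = 1 ↔ y * y = 1) → (x = 1 ↔ y = 1) → y = x ∨ y = x⁻¹ := by decide
  refine h4 _ _ ?_ ?_
  · rw [← map_mul, EmbeddingLike.map_eq_one_iff]
  · rw [EmbeddingLike.map_eq_one_iff]

theorem nonempty_mulAut_C4_equiv : Nonempty (MulAut C4 ≃* Multiplicative (ZMod 2)) := by
  have : Fact (Nat.Prime 2) := ⟨Nat.prime_two⟩
  refine ⟨mulEquivOfPrimeCardEq (p := 2) ?_ (by simp)⟩
  rw [Nat.card_congr (IsCyclic.mulAutMulEquiv C4).toEquiv]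
  simp
  decide

/-- For `A` of order two, a homomorphism `C₄ → A` is determined by an arbitrary value at a
generator. -/
theorem nonempty_C4_hom_equiv {A : Type*} [CommGroup A] (hA : Nat.card A = 2) :
    Nonempty ((C4 →* A) ≃* Multiplicative (ZMod 2)) := by
  have : Fact (Nat.Prime 2) := ⟨Nat.prime_two⟩
  let g : C4 := Multiplicative.ofAdd 1
  refine ⟨(MulEquiv.ofBijective (MonoidHom.eval g) ⟨?_, fun a => ?_⟩).trans
    (mulEquivOfPrimeCardEq (p := 2) hA (by simp))⟩
  · intro φ ψ h
    have hg : ∀ k : C4, ∃ n : Fin 4, k = g ^ (n : ℕ) := by decide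
    refine MonoidHom.ext fun k => ?_
    obtain ⟨n, rfl⟩ := hg k
    rw [map_pow, map_pow]
    exact congrArg (· ^ (n : ℕ)) h
  · have ha : a ^ 4 = 1 := by
      rw [show 4 = 2 * 2 from rfl, pow_mul, ← hA, pow_card_eq_one']
    let φ : {φ : ℤ →+ Additive A // φ (4 : ℕ) = 0} :=
      ⟨zmultiplesHom (Additive A) (Additive.ofMul a),
        congrArg Additive.ofMul ((zpow_natCast a 4).trans ha)⟩
    exact ⟨AddMonoidHom.toMultiplicativeLeft (ZMod.lift 4 φ),
      (congrArg Additive.toMul (ZMod.lift_coe 4 φ 1)).trans (zpow_one a)⟩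

end CyclicFour

namespace SL23

local notation "G" => Matrix.SpecialLinearGroup (Fin 2) (ZMod 3)

/-- Representatives of the four subgroups of order three of `SL(2,3)`. -/
def root : Fin 4 → G :=
  ![⟨!![1, 1; 0, 1], by decide⟩, ⟨!![1, 0; 2, 1], by decide⟩,
    ⟨!![0, 1; 2, 2], by decide⟩, ⟨!![2, 1; 2, 0], by decide⟩]

/-- The index of the subgroup of order three containing `x`; the value is only meaningful if `x`
has order three. -/
def index (x : G) : Fin 4 :=
  if x 1 0 = 0 then 0 else if x 0 1 = 0 then 1 else if x 0 0 + x 0 1 = 1 then 2 else 3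

theorem index_root : ∀ i, index (root i) = i := by decide +kernel

theorem root_pow_three : ∀ i, root i ^ 3 = 1 := by decide +kernel

theorem root_ne_one : ∀ i, root i ≠ 1 := by decide +kernel

theorem eq_root_index_or : ∀ x : G, x ^ 3 = 1 → x ≠ 1 →
    x = root (index x) ∨ x = root (index x) ^ 2 := by decide +kernel

theorem index_sq : ∀ x : G, x ^ 3 = 1 → index (x ^ 2) = index x := by decide +kernel

theorem eq_word_in_roots : ∀ x : G, ∃ a b c d : Fin 3,
    x = root 0 ^ (a : ℕ) * root 1 ^ (b : ℕ) * root 0 ^ (c : ℕ) * root 1 ^ (d : ℕ) := by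
  decide +kernel

theorem monoidHom_ext {M : Type*} [Monoid M] {φ ψ : G →* M} (h0 : φ (root 0) = ψ (root 0))
    (h1 : φ (root 1) = ψ (root 1)) : φ = ψ := by
  refine MonoidHom.ext fun x => ?_
  obtain ⟨a, b, c, d, rfl⟩ := eq_word_in_roots x
  simp only [map_mul, map_pow, h0, h1]

theorem hom_C4_eq_one (φ : G →* Multiplicative (ZMod 4)) : φ = 1 := by
  have h : ∀ k : Multiplicative (ZMod 4), k ^ 3 = 1 → k = 1 := by decide
  have hφ (i : Fin 4) : φ (root i) = 1 := h _ (by rw [← map_pow, root_pow_three, map_one])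
  exact monoidHom_ext (hφ 0) (hφ 1)

theorem mem_center_iff (x : G) : x ∈ Subgroup.center G ↔ x ^ 2 = 1 := by
  rw [Subgroup.mem_center_iff]
  revert x
  decide +kernel

theorem eq_of_sq_eq_one : ∀ x y : G, x ^ 2 = 1 → y ^ 2 = 1 → (x = 1 ↔ y = 1) → x = y := by
  decide +kernel

theorem mulAut_apply_of_mem_center (f : MulAut G) (z : G) (hz : z ∈ Subgroup.center G) :
    f z = z := by
  rw [mem_center_iff] at hz
  exact eq_of_sq_eq_one _ _ (by rw [← map_pow, hz, map_one]) hz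
    (EmbeddingLike.map_eq_one_iff (f := f))

theorem card_center : Nat.card (Subgroup.center G) = 2 := by
  have h : Nat.card {x : G // x ^ 2 = 1} = 2 := by
    rw [Nat.card_eq_fintype_card]
    decide +kernel
  exact (Nat.card_congr (Equiv.subtypeEquivRight mem_center_iff)).trans h

theorem index_apply_root_index (f : MulAut G) (x : G) (h : x ^ 3 = 1) (h1 : x ≠ 1) :
    index (f (root (index x))) = index (f x) := by
  have hf : f (root (index x)) ^ 3 = 1 := by rw [← map_pow, root_pow_three, map_one]
  rcases eq_root_index_or x h h1 with e | e
  · rw [← e]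
  · conv_rhs => rw [e, map_pow, index_sq _ hf]

/-- The action of the automorphism group of `SL(2,3)` on the four subgroups of order three. -/
def indexHom : MulAut G →* Equiv.Perm (Fin 4) :=
  MonoidHom.toHomPerm
    { toFun f i := index (f (root i))
      map_one' := funext index_root
      map_mul' f g := funext fun i => (index_apply_root_index f (g (root i))
        (by rw [← map_pow, root_pow_three, map_one])
        (by simpa using root_ne_one i)).symm }

theorem indexHom_apply (f : MulAut G) (i : Fin 4) : indexHom f i = index (f (root i)) := rfl

theorem conj_zero_one : root 0 * root 1 * root 0 ^ 2 = root 2 := by decide +kernel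

theorem conj_one_zero : root 1 * root 0 * root 1 ^ 2 = root 3 := by decide +kernel

/-- An automorphism of `SL(2,3)` preserving all subgroups of order three is trivial. -/
theorem indexHom_injective : Function.Injective indexHom := by
  refine (injective_iff_map_eq_one _).2 fun f hf => ?_
  have h (i : Fin 4) : f (root i) = root i ∨ f (root i) = root i ^ 2 := by
    have hi : index (f (root i)) = i := by rw [← indexHom_apply, hf, Equiv.Perm.one_apply]
    simpa only [hi] using eq_root_index_or (f (root i))
      (by rw [← map_pow, root_pow_three, map_one]) (by simpa using root_ne_one i)
  have h2 : f (root 0) * f (root 1) * f (root 0) ^ 2 = f (root 2) := by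
    rw [← conj_zero_one, map_mul, map_mul, map_pow]
  have h3 : f (root 1) * f (root 0) * f (root 1) ^ 2 = f (root 3) := by
    rw [← conj_one_zero, map_mul, map_mul, map_pow]
  have key : ∀ a ∈ [root 0, root 0 ^ 2], ∀ b ∈ [root 1, root 1 ^ 2],
      a * b * a ^ 2 ∈ [root 2, root 2 ^ 2] → b * a * b ^ 2 ∈ [root 3, root 3 ^ 2] →
      a = root 0 ∧ b = root 1 := by decide +kernel
  obtain ⟨e0, e1⟩ := key _ (by simpa using h 0) _ (by simpa using h 1)
    (by rw [h2]; simpa using h 2) (by rw [h3]; simpa using h 3)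
  have : f.toMonoidHom = MonoidHom.id G := monoidHom_ext e0 e1
  exact MulEquiv.ext fun x => DFunLike.congr_fun this x

/-- Conjugation by an invertible matrix, as an automorphism of the special linear group. -/
def conjGL (M : GL (Fin 2) (ZMod 3)) : MulAut G where
  toFun x := ⟨M * x.1 * (M⁻¹ : GL (Fin 2) (ZMod 3)), by
    rw [Matrix.det_units_conj, x.2]⟩
  invFun x := ⟨(M⁻¹ : GL (Fin 2) (ZMod 3)) * x.1 * M, by
    rw [Matrix.det_units_conj', x.2]⟩
  left_inv x := Subtype.ext (by simp [mul_assoc])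
  right_inv x := Subtype.ext (by simp [mul_assoc])
  map_mul' x y := Subtype.ext <| by
    change M * (x.1 * y.1) * (M⁻¹ : GL (Fin 2) (ZMod 3)) =
      M * x.1 * (M⁻¹ : GL (Fin 2) (ZMod 3)) * (M * y.1 * (M⁻¹ : GL (Fin 2) (ZMod 3)))
    simp [mul_assoc]

theorem indexHom_surjective : Function.Surjective indexHom := by
  rw [← MonoidHom.range_eq_top, eq_top_iff,
    ← Equiv.Perm.closure_cycle_adjacent_swap (isCycle_finRotate (n := 2)) support_finRotate 0,
    Subgroup.closure_le]
  rintro _ (rfl | rfl)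
  · refine ⟨conjGL ⟨!![0, 1; 1, 1], !![2, 1; 1, 0], by decide, by decide⟩, Equiv.ext ?_⟩
    decide +kernel
  · refine ⟨conjGL ⟨!![0, 1; 1, 0], !![0, 1; 1, 0], by decide, by decide⟩, Equiv.ext ?_⟩
    decide +kernel

/-- The automorphism group of `SL(2,3)` is the symmetric group on its four subgroups of order
three. -/
noncomputable def mulAutEquiv : MulAut G ≃* Equiv.Perm (Fin 4) :=
  MulEquiv.ofBijective indexHom ⟨indexHom_injective, indexHom_surjective⟩

theorem hom_center_mulAut_apply (β : Multiplicative (ZMod 4) →* Subgroup.center G)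
    (δ : MulAut (Multiplicative (ZMod 4))) (k : Multiplicative (ZMod 4)) : β (δ k) = β k := by
  rcases mulAut_C4_apply δ k with h | h
  · rw [h]
  · rw [h, map_inv, inv_eq_iff_mul_eq_one, ← pow_two]
    exact Subtype.ext ((mem_center_iff _).1 (β k).2)

end SL23

/-- The automorphism group of `SL(2,3) × C₄` (a group of order 96) is isomorphic to
`S₄ × C₂ × C₂`. -/
theorem aut_SL23xC4_iso_S4xC2xC2 :
    Nonempty
      (MulAut (Matrix.SpecialLinearGroup (Fin 2) (ZMod 3) × Multiplicative (ZMod 4)) ≃*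
        Equiv.Perm (Fin 4) × Multiplicative (ZMod 2) × Multiplicative (ZMod 2)) := by
  obtain ⟨e₁⟩ := nonempty_mulAut_C4_equiv
  obtain ⟨e₂⟩ := nonempty_C4_hom_equiv SL23.card_center
  exact ⟨(mulAutProdEquiv SL23.hom_C4_eq_one SL23.mulAut_apply_of_mem_center
    SL23.hom_center_mulAut_apply).symm.trans (SL23.mulAutEquiv.prodCongr (e₁.prodCongr e₂))⟩
end

section
/- The automorphism group of GL(2,3) × C₂ (a group of order 96, where GL(2,3) is the general linear group of invertible 2×2 matrices over the field with 3 elements) is isomorphic to S₄ × D₄. -/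
open Matrix

namespace DihedralGroup

variable {n : ℕ} {A : Type*} [Group A]

/-- The homomorphism `ZMod n → A` sending `1` to an element `a` with `a ^ n = 1`. -/
def powHom (a : A) (ha : a ^ n = 1) : ZMod n →+ Additive A :=
  ZMod.lift n ⟨zmultiplesHom (Additive A) (Additive.ofMul a), by
    simpa [← ofMul_pow] using ha⟩

lemma powHom_intCast (a : A) (ha : a ^ n = 1) (k : ℤ) :
    (powHom a ha k).toMul = a ^ k := by
  simp [powHom]

lemma mul_powHom {a b : A} (ha : a ^ n = 1) (hb : b * b = 1) (hab : b * a * b = a⁻¹)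
    (i : ZMod n) : (powHom a ha i).toMul * b = b * (powHom a ha (-i)).toMul := by
  obtain ⟨k, rfl⟩ := ZMod.intCast_surjective i
  have hb' : b⁻¹ = b := inv_eq_of_mul_eq_one_left hb
  have h := conj_zpow (i := k) (a := b) (b := a)
  rw [hb', hab] at h
  rw [← Int.cast_neg, powHom_intCast, powHom_intCast, _root_.zpow_neg, ← _root_.inv_zpow, h]
  simp only [← mul_assoc, hb, one_mul]

/-- The homomorphism out of a dihedral group given by its standard presentation. -/
def lift (a b : A) (ha : a ^ n = 1) (hb : b * b = 1) (hab : b * a * b = a⁻¹) :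
    DihedralGroup n →* A where
  toFun
    | r i => (powHom a ha i).toMul
    | sr i => b * (powHom a ha i).toMul
  map_one' := by simp only [one_def, map_zero, toMul_zero]
  map_mul' := by
    have key := mul_powHom ha hb hab
    rintro (i | i) (j | j)
    · simp
    · simp only [r_mul_sr]
      rw [← mul_assoc, key, mul_assoc, ← toMul_add, ← map_add, neg_add_eq_sub]
    · simp [mul_assoc]
    · simp only [sr_mul_sr]
      rw [← mul_assoc, mul_assoc b, key, ← mul_assoc, hb, one_mul, ← toMul_add, ← map_add,
        neg_add_eq_sub]

variable {a b : A} (ha : a ^ n = 1) (hb : b * b = 1) (hab : b * a * b = a⁻¹)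

lemma lift_mem (H : Subgroup A) (haH : a ∈ H) (hbH : b ∈ H) (d : DihedralGroup n) :
    lift a b ha hb hab d ∈ H := by
  rcases d with i | i <;> obtain ⟨k, rfl⟩ := ZMod.intCast_surjective i
  · change (powHom a ha k).toMul ∈ H
    rw [powHom_intCast]
    exact H.zpow_mem haH k
  · change b * (powHom a ha k).toMul ∈ H
    rw [powHom_intCast]
    exact H.mul_mem hbH (H.zpow_mem haH k)

end DihedralGroup

namespace CentralAut

lemma map_mul_self {G C : Type*} [Group G] [CommGroup C] (ζ : C →* G)
    (hC : ∀ t : C, t * t = 1) (t : C) : ζ t * ζ t = 1 := by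
  rw [← map_mul, hC, map_one]

variable {G C : Type*} [Group G] [CommGroup C] (δ : G →* C) (ζ : C →* G)
  (hC : ∀ t : C, t * t = 1) (hζ : ∀ t g, Commute (ζ t) g) (hδζ : ∀ t, δ (ζ t) = 1)

/-- The central automorphism `(g, t) ↦ (g * ζ t, t)`. -/
def shear : MulAut (G × C) where
  toFun p := (p.1 * ζ p.2, p.2)
  invFun p := (p.1 * ζ p.2, p.2)
  left_inv p := by simp [mul_assoc, map_mul_self ζ hC]
  right_inv p := by simp [mul_assoc, map_mul_self ζ hC]
  map_mul' p q := by
    ext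
    · simp only [Prod.fst_mul, Prod.snd_mul, map_mul, mul_assoc]
      rw [← mul_assoc (ζ p.2) q.1, (hζ p.2 q.1).eq, mul_assoc]
    · rfl

/-- The central automorphism `(g, t) ↦ (g * ζ t, t * δ g)`. -/
def rotation : MulAut (G × C) where
  toFun p := (p.1 * ζ p.2, p.2 * δ p.1)
  invFun p := (p.1 * ζ (p.2 * δ p.1), p.2 * δ p.1)
  left_inv p := by
    ext <;> simp [mul_assoc, map_mul_self ζ hC, hδζ, hC]
  right_inv p := by
    have h : ζ (p.2 * δ p.1) * ζ (p.2 * δ p.1) = 1 := map_mul_self ζ hC _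
    ext
    · simp only [mul_assoc, h, mul_one]
    · simp [mul_assoc, hδζ, hC]
  map_mul' p q := by
    ext
    · simp only [Prod.fst_mul, Prod.snd_mul, map_mul, mul_assoc]
      rw [← mul_assoc (ζ p.2) q.1, (hζ p.2 q.1).eq, mul_assoc]
    · simp [mul_mul_mul_comm]

lemma shear_apply (g : G) (t : C) : shear ζ hC hζ (g, t) = (g * ζ t, t) := rfl

lemma rotation_apply (g : G) (t : C) :
    rotation δ ζ hC hζ hδζ (g, t) = (g * ζ t, t * δ g) := rfl

lemma rotation_sq_apply (g : G) (t : C) :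
    (rotation δ ζ hC hζ hδζ ^ 2) (g, t) = (g * ζ (δ g), t) := by
  have h := map_mul_self ζ hC t
  simp only [pow_two, MulAut.mul_apply, rotation_apply, map_mul, hδζ, mul_one]
  rw [← mul_assoc, mul_assoc g, h, mul_one, mul_assoc, hC, mul_one]

lemma rotation_pow_four : rotation δ ζ hC hζ hδζ ^ 4 = 1 := by
  ext1 ⟨g, t⟩
  rw [show 4 = 2 + 2 from rfl, pow_add, MulAut.mul_apply, rotation_sq_apply, rotation_sq_apply,
    map_mul, hδζ, mul_one, mul_assoc, map_mul_self ζ hC, mul_one, MulAut.one_apply]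

lemma shear_mul_self : shear ζ hC hζ * shear ζ hC hζ = 1 := by
  ext1 ⟨g, t⟩
  simp [shear_apply, mul_assoc, map_mul_self ζ hC]

lemma shear_mul_rotation_mul_shear :
    shear ζ hC hζ * rotation δ ζ hC hζ hδζ * shear ζ hC hζ = (rotation δ ζ hC hζ hδζ)⁻¹ := by
  refine eq_inv_of_mul_eq_one_left ?_
  ext1 ⟨g, t⟩
  simp only [MulAut.mul_apply, MulAut.one_apply, shear_apply, rotation_apply, map_mul, hδζ,
    mul_one]
  have h := map_mul_self ζ hC
  ext
  · have h' : ζ (δ g) * (ζ t * (ζ (δ g) * ζ t)) = 1 := by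
      rw [← mul_assoc, ← map_mul, h]
    simp only [mul_assoc]
    simp [h, h']
  · simp [mul_assoc, hC]

/-- The action of the dihedral group of order `8` on `G × C` by central automorphisms. -/
def dihedralHom : DihedralGroup 4 →* MulAut (G × C) :=
  DihedralGroup.lift (rotation δ ζ hC hζ hδζ) (shear ζ hC hζ)
    (rotation_pow_four δ ζ hC hζ hδζ) (shear_mul_self ζ hC hζ)
    (shear_mul_rotation_mul_shear δ ζ hC hζ hδζ)

lemma dihedralHom_apply_of_map_eq_one (d : DihedralGroup 4) {g : G} (hg : δ g = 1) :
    dihedralHom δ ζ hC hζ hδζ d (g, 1) = (g, 1) := by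
  refine DihedralGroup.lift_mem _ _ _ (MulAction.stabilizer (MulAut (G × C)) (g, (1 : C)))
    ?_ ?_ d
  · change rotation δ ζ hC hζ hδζ (g, 1) = (g, 1)
    simp [rotation_apply, hg]
  · change shear ζ hC hζ (g, 1) = (g, 1)
    simp [shear_apply]

/-- Conjugation on the first factor of `G × C`. -/
def conjFst : G →* MulAut (G × C) :=
  MulAut.conj.comp (MonoidHom.inl G C)

lemma conjFst_apply (g h : G) (t : C) :
    conjFst g (h, t) = (g * h * g⁻¹, t) := by
  simp [conjFst]

lemma commute_conjFst_dihedralHom (g : G) (d : DihedralGroup 4) :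
    Commute (conjFst g) (dihedralHom δ ζ hC hζ hδζ d) := by
  have h : dihedralHom δ ζ hC hζ hδζ d ∈ Subgroup.centralizer {conjFst (C := C) g} := by
    refine DihedralGroup.lift_mem _ _ _ _ ?_ ?_ d <;> rw [Subgroup.mem_centralizer_singleton_iff]
    all_goals
      ext1 ⟨h, t⟩
      simp only [MulAut.mul_apply, conjFst_apply, rotation_apply, shear_apply]
      ext
      · simp only [mul_assoc, (hζ t g⁻¹).eq]
      · simp
  exact (Subgroup.mem_centralizer_singleton_iff.mp h).symm

/-- The combined action of `G`, by inner automorphisms, and of the dihedral group of order `8`. -/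
def autHom : G × DihedralGroup 4 →* MulAut (G × C) :=
  MonoidHom.noncommCoprod conjFst (dihedralHom δ ζ hC hζ hδζ)
    (commute_conjFst_dihedralHom δ ζ hC hζ hδζ)

lemma autHom_apply (g : G) (d : DihedralGroup 4) :
    autHom δ ζ hC hζ hδζ (g, d) = conjFst g * dihedralHom δ ζ hC hζ hδζ d := rfl

end CentralAut

namespace GL23

local notation "M₂" => Matrix (Fin 2) (Fin 2) (ZMod 3)
local notation "G₂" => Matrix.GeneralLinearGroup (Fin 2) (ZMod 3)
local notation "C₂" => Multiplicative (ZMod 2)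

/-- The standard upper transvection. -/
def upper : G₂ := ⟨!![1, 1; 0, 1], !![1, 2; 0, 1], by decide, by decide⟩

/-- The reflection exchanging the two coordinates. -/
def swap : G₂ := ⟨!![0, 1; 1, 0], !![0, 1; 1, 0], by decide, by decide⟩

/-- The nontrivial element of the cyclic group of order two. -/
def gen : C₂ := Multiplicative.ofAdd 1

lemma eq_one_or_gen (t : C₂) : t = 1 ∨ t = gen := by
  revert t; decide

lemma mul_self (t : C₂) : t * t = 1 := by
  revert t; decide

/-- The determinant of `GL(2,3)` with values in the cyclic group of order two. -/
def detHom : G₂ →* C₂ :=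
  MonoidHom.comp
    { toFun := fun u : (ZMod 3)ˣ => if (u : ZMod 3) = 1 then 1 else gen
      map_one' := by decide
      map_mul' := by decide }
    Matrix.GeneralLinearGroup.det

/-- The embedding of the cyclic group of order two as the centre `{1, -1}`. -/
def centreHom : C₂ →* G₂ where
  toFun t := if t = 1 then 1 else -1
  map_one' := by simp
  map_mul' s t := by
    rcases eq_one_or_gen s with rfl | rfl <;> rcases eq_one_or_gen t with rfl | rfl <;>
      simp [gen, mul_self]

lemma centreHom_gen : centreHom gen = -1 := rfl

lemma centreHom_commute (t : C₂) (g : G₂) : Commute (centreHom t) g := by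
  rcases eq_one_or_gen t with rfl | rfl
  · simp
  · rw [centreHom_gen]
    exact Commute.neg_one_left g

lemma detHom_centreHom (t : C₂) : detHom (centreHom t) = 1 := by
  revert t; decide +kernel

lemma detHom_upper : detHom upper = 1 := by decide +kernel

lemma eq_one_or_neg_one {w : G₂} (h₁ : Commute w upper) (h₂ : Commute w (swap * upper * swap⁻¹)) :
    w = 1 ∨ w = -1 := by
  have key : ∀ M : M₂, M.det ≠ 0 → M * upper.val = upper.val * M →
      M * (swap * upper * swap⁻¹).val = (swap * upper * swap⁻¹).val * M → M = 1 ∨ M = -1 := by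
    decide +kernel
  rcases key w w.det_ne_zero (congrArg Units.val h₁.eq) (congrArg Units.val h₂.eq) with h | h
  · exact Or.inl (Units.ext h)
  · exact Or.inr (Units.ext h)

lemma exists_conj_upper {u : G₂} (h₁ : u ^ 3 = 1) (h₂ : u ≠ 1) :
    ∃ g : G₂, u = g * upper * g⁻¹ := by
  have key : ∀ M : M₂, M ^ 3 = 1 → M ≠ 1 →
      ∃ g : M₂, g.det ≠ 0 ∧ g * upper.val = M * g := by
    decide +kernel
  obtain ⟨g, hg, h⟩ := key u (congrArg Units.val h₁) (fun h => h₂ (Units.ext h))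
  refine ⟨GeneralLinearGroup.mkOfDetNeZero g hg, eq_mul_inv_of_mul_eq (Units.ext h.symm)⟩

lemma exists_conj_swap {v : G₂} (h₁ : v ^ 2 = 1) (h₂ : (upper * v) ^ 8 = 1)
    (h₃ : (upper * v) ^ 4 ≠ 1) :
    ∃ (k : ℕ) (t : C₂), v = upper ^ k * (swap * centreHom t) * (upper ^ k)⁻¹ := by
  have key : ∀ M : M₂, M ^ 2 = 1 → (upper.val * M) ^ 8 = 1 → (upper.val * M) ^ 4 ≠ 1 →
      ∃ k : Fin 3, ∃ t : C₂,
        M * upper.val ^ (k : ℕ) = upper.val ^ (k : ℕ) * (swap.val * (centreHom t).val) := by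
    decide +kernel
  obtain ⟨k, t, h⟩ := key v (congrArg Units.val h₁) (congrArg Units.val h₂)
    (fun h => h₃ (Units.ext h))
  exact ⟨k, t, eq_mul_inv_of_mul_eq (Units.ext h)⟩

lemma closure_upper_swap : Subgroup.closure {upper, swap} = (⊤ : Subgroup G₂) := by
  have key : ∀ M : M₂, M.det ≠ 0 → ∃ (i : Fin 8) (j : Fin 3) (l : Fin 2) (k : Fin 3),
      M = (upper.val * swap.val) ^ (i : ℕ) * upper.val ^ (j : ℕ) * swap.val ^ (l : ℕ) *
        upper.val ^ (k : ℕ) := by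
    decide +kernel
  refine (Subgroup.eq_top_iff' _).mpr fun g => ?_
  obtain ⟨i, j, l, k, h⟩ := key g g.det_ne_zero
  have hg : g = (upper * swap) ^ (i : ℕ) * upper ^ (j : ℕ) * swap ^ (l : ℕ) *
      upper ^ (k : ℕ) := Units.ext h
  have hu : upper ∈ Subgroup.closure {upper, swap} := Subgroup.subset_closure (by simp)
  have hs : swap ∈ Subgroup.closure {upper, swap} := Subgroup.subset_closure (by simp)
  rw [hg]
  exact mul_mem (mul_mem (mul_mem (pow_mem (mul_mem hu hs) _) (pow_mem hu _)) (pow_mem hs _))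
    (pow_mem hu _)

lemma aut_ext {φ ψ : MulAut (G₂ × C₂)} (h₁ : φ (upper, 1) = ψ (upper, 1))
    (h₂ : φ (swap, 1) = ψ (swap, 1)) (h₃ : φ (1, gen) = ψ (1, gen)) : φ = ψ := by
  have hG : ∀ g : G₂, φ (g, 1) = ψ (g, 1) := by
    have : (φ.toMonoidHom.comp (MonoidHom.inl G₂ C₂)) = ψ.toMonoidHom.comp (.inl G₂ C₂) := by
      refine MonoidHom.eq_of_eqOn_dense closure_upper_swap ?_
      rintro _ (rfl | rfl)
      · exact h₁
      · exact h₂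
    exact DFunLike.congr_fun this
  ext1 ⟨g, t⟩
  rw [show (g, t) = (g, 1) * (1, t) by simp, map_mul, map_mul, hG]
  rcases eq_one_or_gen t with rfl | rfl
  · rw [hG]
  · rw [h₃]

/-- The action of the dihedral group of order `8` on `GL(2,3) × C₂` by central automorphisms. -/
abbrev dihedralHom : DihedralGroup 4 →* MulAut (G₂ × C₂) :=
  CentralAut.dihedralHom detHom centreHom mul_self centreHom_commute detHom_centreHom

/-- The combined action of `GL(2,3)`, by inner automorphisms, and of the dihedral group. -/
abbrev autHom : G₂ × DihedralGroup 4 →* MulAut (G₂ × C₂) :=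
  CentralAut.autHom detHom centreHom mul_self centreHom_commute detHom_centreHom

lemma dihedralHom_upper (d : DihedralGroup 4) : dihedralHom d (upper, 1) = (upper, 1) :=
  CentralAut.dihedralHom_apply_of_map_eq_one _ _ _ _ _ d detHom_upper

lemma eq_one_of_dihedralHom_eq_one {d : DihedralGroup 4} (h : dihedralHom d = 1) : d = 1 := by
  have key : ∀ d : DihedralGroup 4, dihedralHom d (swap, 1) = (swap, 1) →
      dihedralHom d (1, gen) = (1, gen) → d = 1 := by
    decide +kernel
  exact key d (by rw [h]; rfl) (by rw [h]; rfl)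

lemma exists_dihedralHom_apply : ∀ s t u : C₂, ∃ d : DihedralGroup 4,
    dihedralHom d (swap, 1) = (swap * centreHom s, t) ∧
      dihedralHom d (1, gen) = (centreHom u, gen) := by
  decide +kernel

lemma pow_four_eq_one (t : C₂) : t ^ 4 = 1 := by
  revert t; decide

lemma eq_one_of_pow_three {t : C₂} : t ^ 3 = 1 → t = 1 := by
  revert t; decide

lemma upper_mul_swap_pow_four : (upper * swap) ^ 4 = -1 := by
  decide +kernel

/-- An automorphism fixing `(upper, 1)` and sending `(swap, 1)` to a central multiple of it is one
of the central automorphisms given by the dihedral group. -/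
lemma exists_eq_dihedralHom {φ : MulAut (G₂ × C₂)} (hu : φ (upper, 1) = (upper, 1)) {s t : C₂}
    (hs : φ (swap, 1) = (swap * centreHom s, t)) : ∃ d, dihedralHom d = φ := by
  have hneg : φ (-1, 1) = (-1, 1) := by
    have hpow : ((-1, 1) : G₂ × C₂) = ((upper, 1) * (swap, 1)) ^ 4 := by
      simp [upper_mul_swap_pow_four]
    rw [hpow, map_pow, map_mul, hu, hs]
    ext1
    · rw [Prod.pow_fst, Prod.fst_mul, ← mul_assoc, (centreHom_commute s _).symm.mul_pow,
        Prod.mk_mul_mk, Prod.pow_mk, ← map_pow, pow_four_eq_one]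
      simp
    · simp [pow_four_eq_one]
  rcases hw : φ (1, gen) with ⟨w, t'⟩
  have hcomm : ∀ p, Commute (w, t') (φ p) := by
    intro p
    rw [← hw]
    refine Commute.map ?_ φ
    ext <;> simp [mul_comm]
  have hwu : Commute w upper := by
    simpa [hu, commute_iff_eq] using congrArg Prod.fst (hcomm (upper, 1)).eq
  have hws : Commute w swap := by
    have h : Commute w (swap * centreHom s) := by
      simpa [hs, commute_iff_eq] using congrArg Prod.fst (hcomm (swap, 1)).eq
    simpa using h.mul_right (centreHom_commute s w).symm.inv_right
  obtain ⟨u, rfl⟩ : ∃ u, centreHom u = w := by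
    rcases eq_one_or_neg_one hwu ((hws.mul_right hwu).mul_right hws.inv_right) with rfl | rfl
    · exact ⟨1, map_one _⟩
    · exact ⟨gen, centreHom_gen⟩
  have ht' : t' = gen := by
    rcases eq_one_or_gen t' with rfl | rfl
    · exfalso
      rcases eq_one_or_gen u with rfl | rfl
      · have := φ.injective (hw.trans (map_one φ).symm)
        exact absurd (congrArg Prod.snd this) (by decide)
      · have := φ.injective (hw.trans hneg.symm)
        exact absurd (congrArg Prod.snd this) (by decide)
    · rfl
  subst ht'
  obtain ⟨d, h₁, h₂⟩ := exists_dihedralHom_apply s t u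
  exact ⟨d, aut_ext (by rw [hu, dihedralHom_upper]) (by rw [hs, h₁]) (by rw [hw, h₂])⟩

lemma autHom_surjective : Function.Surjective autHom := by
  intro φ
  rcases hu : φ (upper, 1) with ⟨u, t⟩
  have hu3 : (u, t) ^ 3 = 1 := by
    rw [← hu, ← map_pow, show ((upper, 1) : G₂ × C₂) ^ 3 = 1 by decide +kernel, map_one]
  obtain rfl : t = 1 := eq_one_of_pow_three (congrArg Prod.snd hu3)
  have hu1 : u ≠ 1 := by
    rintro rfl
    exact absurd (φ.injective (hu.trans (map_one φ).symm)) (by decide +kernel)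
  obtain ⟨g, rfl⟩ := exists_conj_upper (congrArg Prod.fst hu3) hu1
  set ψ : MulAut (G₂ × C₂) := CentralAut.conjFst g⁻¹ * φ with hψ
  have hψu : ψ (upper, 1) = (upper, 1) := by
    rw [hψ, MulAut.mul_apply, hu, CentralAut.conjFst_apply]
    simp [mul_assoc]
  rcases hv : ψ (swap, 1) with ⟨v, t⟩
  have hv2 : (v, t) ^ 2 = 1 := by
    rw [← hv, ← map_pow, show ((swap, 1) : G₂ × C₂) ^ 2 = 1 by decide +kernel, map_one]
  have hpow : ∀ n, ψ (((upper, 1) * (swap, 1)) ^ n) = ((upper * v) ^ n, t ^ n) := by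
    intro n
    rw [map_pow, map_mul, hψu, hv]
    simp
  have hv8 : (upper * v) ^ 8 = 1 := by
    have h := hpow 8
    rw [show (((upper, 1) : G₂ × C₂) * (swap, 1)) ^ 8 = 1 by decide +kernel, map_one] at h
    exact (congrArg Prod.fst h).symm
  have hv4 : (upper * v) ^ 4 ≠ 1 := by
    intro h4
    have h := hpow 4
    rw [h4, pow_four_eq_one] at h
    exact absurd (ψ.injective (h.trans (map_one ψ).symm)) (by decide +kernel)
  obtain ⟨k, s, rfl⟩ := exists_conj_swap (congrArg Prod.fst hv2) hv8 hv4
  obtain ⟨d, hd⟩ := exists_eq_dihedralHom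
    (φ := CentralAut.conjFst (upper ^ k)⁻¹ * ψ) (s := s) (t := t)
    (by
      rw [MulAut.mul_apply, hψu, CentralAut.conjFst_apply, inv_inv, mul_assoc,
        (Commute.self_pow upper k).eq, inv_mul_cancel_left])
    (by
      rw [MulAut.mul_apply, hv, CentralAut.conjFst_apply]
      simp [mul_assoc])
  refine ⟨(g * upper ^ k, d), ?_⟩
  rw [CentralAut.autHom_apply, hd, hψ, map_mul, map_inv, map_inv]
  group

lemma autHom_eq_one_iff (g : G₂) (d : DihedralGroup 4) :
    autHom (g, d) = 1 ↔ (g = 1 ∨ g = -1) ∧ d = 1 := by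
  have hconj : g = 1 ∨ g = -1 → CentralAut.conjFst (C := C₂) g = 1 := by
    rintro (rfl | rfl)
    · exact map_one _
    · ext1 ⟨h, t⟩
      rw [CentralAut.conjFst_apply]
      simp
  rw [CentralAut.autHom_apply]
  refine ⟨fun h => ?_, fun ⟨hg, hd⟩ => by rw [hconj hg, hd, map_one, one_mul]⟩
  have hcomm : ∀ x : G₂, detHom x = 1 → Commute g x := by
    intro x hx
    have hx' := DFunLike.congr_fun h (x, (1 : C₂))
    rw [MulAut.mul_apply, CentralAut.dihedralHom_apply_of_map_eq_one _ _ _ _ _ d hx,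
      CentralAut.conjFst_apply] at hx'
    exact mul_inv_eq_iff_eq_mul.mp (congrArg Prod.fst hx')
  have hg := eq_one_or_neg_one (hcomm _ detHom_upper)
    (hcomm (swap * upper * swap⁻¹) (by simp [detHom_upper]))
  rw [hconj hg, one_mul] at h
  exact ⟨hg, eq_one_of_dihedralHom_eq_one h⟩

/-- The action of `GL(2,3)` on the four points of the projective line. -/
abbrev permHom : G₂ →* Equiv.Perm (OnePoint (ZMod 3)) :=
  MulAction.toPermHom G₂ (OnePoint (ZMod 3))

lemma permHom_eq_one_iff (g : G₂) : permHom g = 1 ↔ g = 1 ∨ g = -1 := by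
  constructor
  · intro h
    have hfix : ∀ p : OnePoint (ZMod 3), g • p = p := fun p => DFunLike.congr_fun h p
    have key : ∀ M : M₂, M.det ≠ 0 → M 1 0 = 0 → M 0 1 = 0 → M 0 0 = M 1 1 →
        M = 1 ∨ M = -1 := by
      decide +kernel
    have h₁ := OnePoint.smul_infty_eq_self_iff.mp (hfix OnePoint.infty)
    have hd : g 1 1 ≠ 0 := fun hd => g.det_ne_zero (by simp [det_fin_two, h₁, hd])
    have h₂ := hfix ((0 : ZMod 3) : OnePoint (ZMod 3))
    have h₃ := hfix ((1 : ZMod 3) : OnePoint (ZMod 3))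
    rw [OnePoint.smul_some_eq_ite] at h₂ h₃
    simp only [h₁, zero_mul, zero_add, mul_zero, mul_one, hd, if_false, OnePoint.coe_eq_coe,
      div_eq_iff hd, one_mul] at h₂ h₃
    rw [h₂, add_zero] at h₃
    exact (key g g.det_ne_zero h₁ h₂ h₃).imp (fun h => Units.ext h) (fun h => Units.ext h)
  · rintro (rfl | rfl)
    · exact map_one _
    · ext1 p
      change (-1 : G₂) • p = p
      induction p using OnePoint.rec with
      | infty => simp [OnePoint.smul_infty_eq_ite]
      | coe k => simp [OnePoint.smul_some_eq_ite]

lemma permHom_surjective : Function.Surjective permHom := by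
  have hker : Nat.card permHom.ker = 2 := by
    have h : (permHom.ker : Set G₂) = {1, -1} := by
      ext g
      simpa using permHom_eq_one_iff g
    rw [← SetLike.coe_sort_coe, h, Nat.card_coe_set_eq, Set.ncard_pair (by decide +kernel)]
  have hG : Nat.card G₂ = 48 := by
    rw [Matrix.card_GL_field]
    simp [Fin.prod_univ_two]
  have hP : Nat.card (Equiv.Perm (OnePoint (ZMod 3))) = 24 := by
    rw [Nat.card_perm, show Nat.card (OnePoint (ZMod 3)) = 4 by
      simp [OnePoint]]
    rfl
  rw [← MonoidHom.range_eq_top, ← Subgroup.card_eq_iff_eq_top, ← Subgroup.index_ker, hP]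
  have := permHom.ker.card_mul_index
  rw [hker, hG] at this
  omega

end GL23

/-- The automorphism group of `GL(2,3) × C₂` (a group of order 96) is isomorphic to
`S₄ × D₄`. -/
theorem aut_GL23xC2_iso_S4xD4 :
    Nonempty
      (MulAut (Matrix.GeneralLinearGroup (Fin 2) (ZMod 3) × Multiplicative (ZMod 2)) ≃*
        Equiv.Perm (Fin 4) × DihedralGroup 4) := by
  have e : OnePoint (ZMod 3) ≃ Fin 4 := (finSuccEquiv 3).symm
  let θ := GL23.permHom.prodMap (MonoidHom.id (DihedralGroup 4))
  have hθ : Function.Surjective θ :=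
    Function.Surjective.prodMap GL23.permHom_surjective Function.surjective_id
  have hker : GL23.autHom.ker = θ.ker := by
    ext ⟨g, d⟩
    rw [MonoidHom.mem_ker, MonoidHom.mem_ker, GL23.autHom_eq_one_iff, ← GL23.permHom_eq_one_iff]
    exact Prod.mk_eq_one.symm
  exact ⟨(QuotientGroup.quotientKerEquivOfSurjective _ GL23.autHom_surjective).symm.trans
    ((QuotientGroup.quotientMulEquivOfEq hker).trans
      ((QuotientGroup.quotientKerEquivOfSurjective θ hθ).trans
        (e.permCongrHom.prodCongr (MulEquiv.refl _))))⟩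
end

section
/- The automorphism group of S₄ × C₂ × C₂ (a group of order 96, where S₄ is the symmetric group on 4 letters) is isomorphic to S₄ × S₄. -/
open Equiv Equiv.Perm

/-- The Klein four-group, as a product of two cyclic groups of order two. -/
abbrev KleinFour : Type := Multiplicative (ZMod 2) × Multiplicative (ZMod 2)

namespace KleinFour

theorem mul_self (v : KleinFour) : v * v = 1 := by
  revert v; decide

/-- Every permutation of the Klein four-group is affine. -/
theorem perm_apply_mul (τ : Perm KleinFour) (v w : KleinFour) :
    τ (v * w) = τ v * τ w * τ 1 := by
  revert τ v w; decide +kernel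

end KleinFour

namespace PermFinFour

theorem closure_swap_finRotate :
    Subgroup.closure {swap 0 1, finRotate 4} = (⊤ : Subgroup (Perm (Fin 4))) := by
  have h := closure_cycle_adjacent_swap (σ := finRotate 4) isCycle_finRotate
    support_finRotate 0
  rw [Set.pair_comm]
  exact h

theorem eq_one_of_forall_commute (σ : Perm (Fin 4)) (h : ∀ g, σ * g = g * σ) : σ = 1 := by
  revert σ; decide +kernel

set_option synthInstance.maxSize 1000 in
/-- Pairs satisfying the `(2, 3, 4)` triangle relations nondegenerately are simultaneously
conjugate to the standard generators. -/
theorem exists_conj_eq_of_relations (a b : Perm (Fin 4)) (ha : a ^ 2 = 1) (hb : b ^ 4 = 1)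
    (hab : (a * b) ^ 3 = 1) (hb2 : b ^ 2 ≠ 1) :
    ∃ σ : Perm (Fin 4), σ * swap 0 1 * σ⁻¹ = a ∧ σ * finRotate 4 * σ⁻¹ = b := by
  revert a b; decide +kernel

theorem hom_ext {M : Type*} [Monoid M] {f g : Perm (Fin 4) →* M}
    (hs : f (swap 0 1) = g (swap 0 1)) (ht : f (finRotate 4) = g (finRotate 4)) : f = g := by
  refine MonoidHom.eq_of_eqOn_dense closure_swap_finRotate ?_
  rintro x (rfl | rfl) <;> assumption

/-- Every injective endomorphism of `S₄` is inner. -/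
theorem exists_eq_conj_of_injective (f : Perm (Fin 4) →* Perm (Fin 4))
    (hf : Function.Injective f) : ∃ σ : Perm (Fin 4), ∀ g, f g = σ * g * σ⁻¹ := by
  obtain ⟨σ, hs, ht⟩ := exists_conj_eq_of_relations (f (swap 0 1)) (f (finRotate 4))
    (by rw [← map_pow, ← map_one f]; congr 1; decide)
    (by rw [← map_pow, ← map_one f]; congr 1; decide)
    (by rw [← map_mul, ← map_pow, ← map_one f]; congr 1; decide)
    (by rw [← map_pow, ← map_one f]; exact hf.ne (by decide))
  refine ⟨σ, fun g => DFunLike.congr_fun (hom_ext (g := (MulAut.conj σ).toMonoidHom) ?_ ?_) g⟩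
  · exact hs.symm
  · exact ht.symm

/-- A homomorphism from `S₄` to the Klein four-group takes equal values on the generators. -/
theorem hom_finRotate_eq (χ : Perm (Fin 4) →* KleinFour) :
    χ (finRotate 4) = χ (swap 0 1) := by
  have h : χ ((swap 0 1 * finRotate 4) ^ 3) = 1 := by
    rw [← map_one χ]; congr 1; decide
  rw [map_pow, map_mul, pow_succ, pow_two, KleinFour.mul_self, one_mul] at h
  rw [← mul_left_cancel_iff (a := χ (swap 0 1)), h, KleinFour.mul_self]

end PermFinFour

/-- `S₄` acts on itself by conjugation, and a permutation `τ` of `V` acts on `S₄ × V` by `τ` on the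
second component over odd permutations, and by the linear part of `τ` over even ones. -/
@[reducible]
def permProdAction :
    MulDistribMulAction (Perm (Fin 4) × Perm KleinFour) (Perm (Fin 4) × KleinFour) where
  smul p x := (p.1 * x.1 * p.1⁻¹, p.2 x.2 * if sign x.1 = 1 then p.2 1 else 1)
  one_smul x := by
    change (_, _) = _
    ext1 <;> simp
  mul_smul p q x := by
    let act (p : Perm (Fin 4) × Perm KleinFour) (x : Perm (Fin 4) × KleinFour) :
        Perm (Fin 4) × KleinFour :=
      (p.1 * x.1 * p.1⁻¹, p.2 x.2 * if sign x.1 = 1 then p.2 1 else 1)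
    change act (p * q) x = act p (act q x)
    ext1
    · simp [act, mul_assoc]
    · by_cases h : sign x.1 = 1
      · simp [act, h, KleinFour.perm_apply_mul p.2 (q.2 x.2) (q.2 1), mul_assoc,
          KleinFour.mul_self]
      · simp [act, h, mul_right_comm (sign q.1)]
  smul_mul p x y := by
    change (_, _) = (_, _) * (_, _)
    ext1
    · simp [mul_assoc]
    · have hc := KleinFour.mul_self (p.2 1)
      have hcc (v : KleinFour) : v * p.2 1 * p.2 1 = v := by rw [mul_assoc, hc, mul_one]
      rcases Int.units_eq_one_or (sign x.1) with hx | hx <;>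
        rcases Int.units_eq_one_or (sign y.1) with hy | hy <;>
        simp [hx, hy, KleinFour.perm_apply_mul p.2 x.2 y.2, hcc, ← mul_assoc, mul_right_comm]
  smul_one p := by
    change (_, _) = _
    ext1
    · simp
    · simp [KleinFour.mul_self]

/-- The homomorphism to the automorphism group induced by `permProdAction`. -/
def permProdToMulAut :
    Perm (Fin 4) × Perm KleinFour →* MulAut (Perm (Fin 4) × KleinFour) :=
  letI := permProdAction
  MulDistribMulAction.toMulAut _ _

theorem permProdToMulAut_apply (p : Perm (Fin 4) × Perm KleinFour)
    (x : Perm (Fin 4) × KleinFour) :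
    permProdToMulAut p x =
      (p.1 * x.1 * p.1⁻¹, p.2 x.2 * if sign x.1 = 1 then p.2 1 else 1) :=
  rfl

theorem permProdToMulAut_injective : Function.Injective permProdToMulAut := by
  rw [injective_iff_map_eq_one]
  rintro ⟨σ, τ⟩ h
  have h' (x : Perm (Fin 4) × KleinFour) :
      (σ * x.1 * σ⁻¹, τ x.2 * if sign x.1 = 1 then τ 1 else 1) = x := DFunLike.congr_fun h x
  refine Prod.ext (PermFinFour.eq_one_of_forall_commute σ fun g => ?_) (Equiv.ext fun v => ?_)
  · exact mul_inv_eq_iff_eq_mul.mp (congrArg Prod.fst (h' (g, 1)))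
  · simpa [sign_swap] using congrArg Prod.snd (h' (swap 0 1, v))

theorem mulAut_fst_apply_eq_one_iff (φ : MulAut (Perm (Fin 4) × KleinFour))
    (x : Perm (Fin 4) × KleinFour) : (φ x).1 = 1 ↔ x.1 = 1 := by
  have key (ψ : MulAut (Perm (Fin 4) × KleinFour)) (y : Perm (Fin 4) × KleinFour)
      (hy : y.1 = 1) : (ψ y).1 = 1 := by
    refine PermFinFour.eq_one_of_forall_commute _ fun g => ?_
    have hc : y * ψ.symm (g, 1) = ψ.symm (g, 1) * y :=
      Prod.ext (by simp [hy]) (mul_comm _ _)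
    simpa using congrArg (fun z => (ψ z).1) hc
  exact ⟨fun h => by simpa using key φ.symm (φ x) h, key φ x⟩

theorem permProdToMulAut_surjective : Function.Surjective permProdToMulAut := by
  intro φ
  let α : Perm (Fin 4) →* Perm (Fin 4) :=
    (MonoidHom.fst _ _).comp (φ.toMonoidHom.comp (MonoidHom.inl _ _))
  let χ : Perm (Fin 4) →* KleinFour :=
    (MonoidHom.snd _ _).comp (φ.toMonoidHom.comp (MonoidHom.inl _ _))
  let β : KleinFour →* KleinFour :=
    (MonoidHom.snd _ _).comp (φ.toMonoidHom.comp (MonoidHom.inr _ _))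
  have hα : Function.Injective α := by
    rw [injective_iff_map_eq_one]
    exact fun g hg => (mulAut_fst_apply_eq_one_iff φ (g, 1)).mp hg
  have hβφ (v : KleinFour) : φ (1, v) = (1, β v) :=
    Prod.ext ((mulAut_fst_apply_eq_one_iff φ (1, v)).mpr rfl) rfl
  have hβ : Function.Injective β := by
    rw [injective_iff_map_eq_one]
    intro v hv
    have h : φ (1, v) = 1 := by rw [hβφ, hv]; rfl
    exact congrArg Prod.snd ((map_eq_one_iff φ φ.injective).mp h)
  obtain ⟨σ, hσ⟩ := PermFinFour.exists_eq_conj_of_injective α hα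
  have hτ : Function.Bijective fun v => χ (swap 0 1) * β v :=
    Finite.injective_iff_bijective.mp fun v w h => hβ (mul_left_cancel h)
  let τ : Perm KleinFour := Equiv.ofBijective _ hτ
  have hτv (v : KleinFour) : τ v = χ (swap 0 1) * β v := rfl
  refine ⟨(σ, τ), ?_⟩
  have hinl : (permProdToMulAut (σ, τ)).toMonoidHom.comp (MonoidHom.inl _ _) =
      φ.toMonoidHom.comp (MonoidHom.inl _ _) := by
    refine PermFinFour.hom_ext (Prod.ext (hσ _).symm ?_) (Prod.ext (hσ _).symm ?_)
    · change τ 1 * (if sign (swap (0 : Fin 4) 1) = 1 then τ 1 else 1) = χ (swap 0 1)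
      simp [hτv]
    · change τ 1 * (if sign (finRotate 4) = 1 then τ 1 else 1) = χ (finRotate 4)
      rw [PermFinFour.hom_finRotate_eq, sign_finRotate, if_neg (by decide)]
      simp [hτv]
  have hinr (v : KleinFour) : permProdToMulAut (σ, τ) (1, v) = φ (1, v) := by
    rw [hβφ, permProdToMulAut_apply]
    ext1
    · simp
    · simp [hτv, mul_right_comm _ (β v), KleinFour.mul_self]
  ext1 ⟨g, v⟩
  have hgv : ((g, v) : Perm (Fin 4) × KleinFour) = (g, 1) * (1, v) := by simp
  rw [hgv, map_mul, map_mul, hinr]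
  exact congrArg (· * φ (1, v)) (DFunLike.congr_fun hinl g)

/-- The automorphism group of `S₄ × C₂ × C₂` (a group of order 96) is isomorphic to
`S₄ × S₄`. -/
theorem aut_S4xC2xC2_iso_S4xS4 :
    Nonempty
      (MulAut (Equiv.Perm (Fin 4) × Multiplicative (ZMod 2) × Multiplicative (ZMod 2)) ≃*
        Equiv.Perm (Fin 4) × Equiv.Perm (Fin 4)) := by
  have e : KleinFour ≃ Fin 4 := Fintype.equivFinOfCardEq (by decide)
  exact ⟨(MulEquiv.ofBijective permProdToMulAut
    ⟨permProdToMulAut_injective, permProdToMulAut_surjective⟩).symm.trans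
      ((MulEquiv.refl _).prodCongr e.permCongrHom)⟩
end
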